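/- Let x : ℕ → ℝ, σ > 0, ρ ∈ ℝ, and suppose (1/n) ∑_{i=0}^{n−1} x_i² → σ² and (1/(n−1)) ∑_{i=1}^{n−1} x_i x_{i−1} → ρσ² as n → ∞. If additionally ρ < 1, then the (unsquared) ratio of deviations RoD(n) = ν(n)/s(n) converges to √(2(1 − ρ)) as n → ∞, where ν(n) = √((1/(n−1)) ∑_{i=1}^{n−1} (x_i − x_{i−1})²) and s(n) = √((1/n) ∑_{i=0}^{n−1} x_i²). -/

import Mathlib

open Filter Finset

/-- Expanding the squares in a sum of squared successive differences. -/
theorem sum_sq_sub_pred (x : ℕ → ℝ) (m : ℕ) :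
    ∑ i ∈ Ico 1 (m + 1), (x i - x (i - 1)) ^ 2 =
      ∑ i ∈ range (m + 1), x i ^ 2 - x 0 ^ 2 + ∑ i ∈ range m, x i ^ 2 -
        2 * ∑ i ∈ Ico 1 (m + 1), x i * x (i - 1) := by
  induction m with
  | zero => simp
  | succ k ih =>
    have hk : 1 ≤ k + 1 := by omega
    rw [sum_Ico_succ_top hk, sum_Ico_succ_top hk, ih,
      sum_range_succ _ (k + 1), sum_range_succ _ k, Nat.add_sub_cancel]
    ring

/-- The sample mean squared successive difference converges to `2 (c - d)` when the sample second
moment converges to `c` and the sample lag-1 moment converges to `d`. -/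
theorem tendsto_mean_sq_sub_pred {x : ℕ → ℝ} {c d : ℝ}
    (h1 : Tendsto (fun n : ℕ => (1 / (n : ℝ)) * ∑ i ∈ range n, (x i) ^ 2) atTop (nhds c))
    (h2 : Tendsto (fun n : ℕ => (1 / ((n : ℝ) - 1)) * ∑ i ∈ Ico 1 n, x i * x (i - 1))
      atTop (nhds d)) :
    Tendsto (fun n : ℕ => (1 / ((n : ℝ) - 1)) * ∑ i ∈ Ico 1 n, (x i - x (i - 1)) ^ 2)
      atTop (nhds (2 * (c - d))) := by
  rw [← tendsto_add_atTop_iff_nat 1] at h2 ⊢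
  have h1' := (tendsto_add_atTop_iff_nat 1).2 h1
  have h0 : Tendsto (fun m : ℕ => 1 / (m : ℝ)) atTop (nhds 0) :=
    tendsto_one_div_atTop_nhds_zero_nat
  have key := (((h1'.mul (h0.const_add 1)).sub (h0.const_mul (x 0 ^ 2))).add h1).sub
    (h2.const_mul 2)
  rw [show c * (1 + 0) - x 0 ^ 2 * 0 + c - 2 * d = 2 * (c - d) by ring] at key
  refine key.congr' ?_
  filter_upwards [eventually_gt_atTop 0] with m hm
  have hm' : (m : ℝ) ≠ 0 := by positivity
  have hm1 : (m : ℝ) + 1 ≠ 0 := by positivity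
  rw [sum_sq_sub_pred]
  push_cast
  rw [add_sub_cancel_right]
  field_simp

/-- Unsquared form of Proposition 1: under convergence of the sample second moments to `σ²`
and the sample lag-1 moments to `ρσ²` with `ρ < 1`, the ratio of deviations
`RoD(n) = ν(n)/s(n)` converges to `√(2(1 − ρ))`. -/
theorem rod_tendsto (x : ℕ → ℝ) (σ ρ : ℝ) (hσ : 0 < σ) (hρ : ρ < 1)
    (h1 : Tendsto (fun n : ℕ => (1 / (n : ℝ)) * ∑ i ∈ range n, (x i) ^ 2)
      atTop (nhds (σ ^ 2)))
    (h2 : Tendsto (fun n : ℕ => (1 / ((n : ℝ) - 1)) * ∑ i ∈ Ico 1 n, x i * x (i - 1))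
      atTop (nhds (ρ * σ ^ 2))) :
    Tendsto (fun n : ℕ =>
      Real.sqrt ((1 / ((n : ℝ) - 1)) * ∑ i ∈ Ico 1 n, (x i - x (i - 1)) ^ 2) /
        Real.sqrt ((1 / (n : ℝ)) * ∑ i ∈ range n, (x i) ^ 2))
      atTop (nhds (Real.sqrt (2 * (1 - ρ)))) := by
  have hs := h1.sqrt
  have hν := (tendsto_mean_sq_sub_pred h1 h2).sqrt
  have hσ2 : 0 < σ ^ 2 := by positivity
  have hlim := hν.div hs (Real.sqrt_pos.2 hσ2).ne'
  have hval : Real.sqrt (2 * (σ ^ 2 - ρ * σ ^ 2)) / Real.sqrt (σ ^ 2) =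
      Real.sqrt (2 * (1 - ρ)) := by
    rw [← Real.sqrt_div' _ hσ2.le]
    congr 1
    field_simp
  rwa [hval] at hlim
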